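/- arXiv:2211.10757 — 3 statements merged into one kernel-verified Lean document; each statement's English description precedes it below -/
import Mathlib

section
/- Fix r₀ > 0 and ε > 0, and let Ψ_ε = (1/2)[(r e^{−εy} − r₀)² + z²] on the open set Ω₀ = {(x,y,z) ∈ ℝ³ : r > 0}, where r = √(x²+y²). If constant vectors a, b ∈ ℝ³ satisfy (a + b×x)·∇Ψ_ε(x) = 0 for every x ∈ Ω₀, then a = b = 0. Consequently Ψ_ε and its toroidal level sets are not invariant under any nontrivial continuous Euclidean isometry. -/
/-- Partial derivative of a scalar field on `ℝ³` in the `i`-th coordinate direction. -/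
noncomputable def pd (i : Fin 3) (f : (Fin 3 → ℝ) → ℝ) (x : Fin 3 → ℝ) : ℝ :=
  fderiv ℝ f x (Pi.single i 1)

/-- Gradient of a scalar field on `ℝ³`. -/
noncomputable def grad (f : (Fin 3 → ℝ) → ℝ) (x : Fin 3 → ℝ) : Fin 3 → ℝ :=
  ![pd 0 f x, pd 1 f x, pd 2 f x]

/-- Divergence of a vector field on `ℝ³`. -/
noncomputable def div3 (w : (Fin 3 → ℝ) → (Fin 3 → ℝ)) (x : Fin 3 → ℝ) : ℝ :=
  pd 0 (fun y => w y 0) x + pd 1 (fun y => w y 1) x + pd 2 (fun y => w y 2) x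

/-- Curl of a vector field on `ℝ³`. -/
noncomputable def curl (w : (Fin 3 → ℝ) → (Fin 3 → ℝ)) (x : Fin 3 → ℝ) : Fin 3 → ℝ :=
  ![pd 1 (fun y => w y 2) x - pd 2 (fun y => w y 1) x,
    pd 2 (fun y => w y 0) x - pd 0 (fun y => w y 2) x,
    pd 0 (fun y => w y 1) x - pd 1 (fun y => w y 0) x]

/-- Cross product on `ℝ³`. -/
def cross3 (u v : Fin 3 → ℝ) : Fin 3 → ℝ :=
  ![u 1 * v 2 - u 2 * v 1, u 2 * v 0 - u 0 * v 2, u 0 * v 1 - u 1 * v 0]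

/-- Dot product on `ℝ³`. -/
def dot3 (u v : Fin 3 → ℝ) : ℝ := u 0 * v 0 + u 1 * v 1 + u 2 * v 2

/-- The cylindrical radius `r = √(x² + y²)`. -/
noncomputable def cylR (p : Fin 3 → ℝ) : ℝ := Real.sqrt (p 0 ^ 2 + p 1 ^ 2)

theorem hasFDerivAt_cylR {p : Fin 3 → ℝ} (hp : 0 < cylR p) :
    HasFDerivAt cylR
      ((1 / (2 * cylR p)) •
        ((2 * p 0) • ContinuousLinearMap.proj (R := ℝ) (φ := fun _ : Fin 3 => ℝ) 0 +
          (2 * p 1) • ContinuousLinearMap.proj (R := ℝ) (φ := fun _ : Fin 3 => ℝ) 1)) p := by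
  have h0 := (hasFDerivAt_apply (𝕜 := ℝ) (F' := fun _ : Fin 3 => ℝ) 0 p).pow 2
  have h1 := (hasFDerivAt_apply (𝕜 := ℝ) (F' := fun _ : Fin 3 => ℝ) 1 p).pow 2
  have hne : p 0 ^ 2 + p 1 ^ 2 ≠ 0 := (Real.sqrt_pos.mp hp).ne'
  refine ((h0.add h1).sqrt hne).congr_fderiv ?_
  simp [cylR]

/-- The gradient of the exponentially deformed torus flux function at points with `y = 0`. -/
theorem grad_flux_of_y_eq_zero {r₀ ε : ℝ} {Ψ : (Fin 3 → ℝ) → ℝ}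
    (hΨ : ∀ p : Fin 3 → ℝ, Ψ p =
      (1 / 2) * ((cylR p * Real.exp (-ε * p 1) - r₀) ^ 2 + p 2 ^ 2))
    {x : ℝ} (hx : x ≠ 0) (z : ℝ) :
    grad Ψ ![x, 0, z] = ![(|x| - r₀) * (x / |x|), -((|x| - r₀) * (ε * |x|)), z] := by
  have hr : cylR ![x, 0, z] = |x| := by simp [cylR, Real.sqrt_sq_eq_abs]
  have hx' : |x| ≠ 0 := abs_ne_zero.mpr hx
  have hR := hasFDerivAt_cylR (p := ![x, 0, z]) (hr ▸ abs_pos.mpr hx)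
  have hy := ((hasFDerivAt_apply (𝕜 := ℝ) (F' := fun _ : Fin 3 => ℝ) 1 ![x, 0, z]).const_mul
    (-ε)).exp
  have hz := (hasFDerivAt_apply (𝕜 := ℝ) (F' := fun _ : Fin 3 => ℝ) 2 ![x, 0, z]).pow 2
  have hD := ((((hR.mul hy).sub_const r₀).pow 2).add hz).const_mul (1 / 2)
  have hD' := (hD.congr_of_eventuallyEq (Filter.Eventually.of_forall hΨ)).fderiv
  ext i
  fin_cases i <;> simp [grad, pd, hD', hr] <;> field_simp

/-- the flux function `Ψ_ε = (1/2)[(r e^{−εy} − r₀)² + z²]` admits no nontrivial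
continuous Euclidean isometry: if `(a + b×x)·∇Ψ_ε = 0` on `{r > 0}` then `a = b = 0`. -/
theorem exponentially_deformed_torus_no_isometry
    (r₀ ε : ℝ) (hr₀ : 0 < r₀) (hε : 0 < ε)
    (Ψ : (Fin 3 → ℝ) → ℝ)
    (hΨ : ∀ p : Fin 3 → ℝ, Ψ p =
      (1/2) * ((cylR p * Real.exp (-ε * p 1) - r₀) ^ 2 + p 2 ^ 2))
    (a b : Fin 3 → ℝ)
    (h : ∀ p : Fin 3 → ℝ, 0 < cylR p → dot3 (a + cross3 b p) (grad Ψ p) = 0) :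
    a = 0 ∧ b = 0 := by
  have key : ∀ x z : ℝ, x ≠ 0 →
      (a 0 + b 1 * z) * ((|x| - r₀) * (x / |x|)) -
        (a 1 + b 2 * x - b 0 * z) * ((|x| - r₀) * (ε * |x|)) + (a 2 - b 1 * x) * z = 0 := by
    intro x z hx
    have hp : 0 < cylR ![x, 0, z] := by simpa [cylR, Real.sqrt_sq_eq_abs] using hx
    have := h _ hp
    rw [grad_flux_of_y_eq_zero hΨ hx] at this
    simp [dot3, cross3] at this
    linear_combination this
  have pos : ∀ t z : ℝ, 0 < t →
      (t - r₀) * ((a 0 + b 1 * z) - (a 1 + b 2 * t - b 0 * z) * (ε * t)) +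
        (a 2 - b 1 * t) * z = 0 := by
    intro t z ht
    have := key t z ht.ne'
    rw [abs_of_pos ht, div_self ht.ne'] at this
    linear_combination this
  have neg : ∀ t z : ℝ, 0 < t →
      (t - r₀) * (-(a 0 + b 1 * z) - (a 1 - b 2 * t - b 0 * z) * (ε * t)) +
        (a 2 + b 1 * t) * z = 0 := by
    intro t z ht
    have := key (-t) z (neg_ne_zero.mpr ht.ne')
    rw [abs_neg, abs_of_pos ht, neg_div, div_self ht.ne'] at this
    linear_combination this
  have h2 : 0 < 2 * r₀ := by positivity
  have h3 : 0 < 3 * r₀ := by positivity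
  have ha1 : a 1 = 0 := by
    have : a 1 * (r₀ * ε * r₀) = 0 := by
      linear_combination (-1 / 4) * pos _ 0 h2 + (-1 / 4) * neg _ 0 h2
    exact (mul_eq_zero.mp this).resolve_right (by positivity)
  have hb2 : b 2 = 0 := by
    have : b 2 * (r₀ * ε * r₀ ^ 2) = 0 := by
      linear_combination (1 / 10) * (pos _ 0 h2 - neg _ 0 h2) -
        (1 / 20) * (pos _ 0 h3 - neg _ 0 h3)
    exact (mul_eq_zero.mp this).resolve_right (by positivity)
  have ha0 : a 0 = 0 := by
    have : a 0 * r₀ = 0 := by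
      linear_combination pos _ 0 h2 + 2 * r₀ ^ 2 * ε * ha1 + 4 * r₀ ^ 3 * ε * hb2
    exact (mul_eq_zero.mp this).resolve_right hr₀.ne'
  have hb1 : b 1 = 0 := by
    have : b 1 * r₀ = 0 := by
      linear_combination (-1 / 2) * (pos _ 1 hr₀ - neg _ 1 hr₀)
    exact (mul_eq_zero.mp this).resolve_right hr₀.ne'
  have ha2 : a 2 = 0 := by
    linear_combination (1 / 2) * (pos _ 1 hr₀ + neg _ 1 hr₀)
  have hb0 : b 0 = 0 := by
    have : b 0 * (r₀ * ε * r₀) = 0 := by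
      linear_combination (1 / 4) * (pos _ 1 h2 + neg _ 1 h2) - (1 / 2) * ha2 +
        r₀ ^ 2 * ε * ha1
    exact (mul_eq_zero.mp this).resolve_right (by positivity)
  constructor <;> ext i <;> fin_cases i <;> assumption
end

section
/- Let Ω ⊂ ℝ³ be open, let Ψ : Ω → ℝ be continuously differentiable, and let ξ : Ω → ℝ³ be continuously differentiable with ∇×ξ = 0, ∇·ξ = 0, and ξ·∇Ψ = 0 on Ω. Let f : ℝ → ℝ be continuously differentiable and nowhere zero, set w = f(Ψ) ξ and γ = 1 − 1/f(Ψ)². Then w is an equilibrium of anisotropic magnetohydrodynamics with zero reference pressure: on Ω, (1 − γ)(∇×w)×w = −(1/2)|w|² ∇γ + (w·∇γ) w, together with ∇·w = 0 (so the force-balance equation (1−γ)(∇×w)×w = ∇P − (1/2)|w|²∇γ + (w·∇γ)w holds with P = 0). -/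
lemma pd_comp {f : ℝ → ℝ} {Ψ : (Fin 3 → ℝ) → ℝ} {x : Fin 3 → ℝ} {d : ℝ} (i : Fin 3)
    (hf : HasDerivAt f d (Ψ x)) (hΨ : DifferentiableAt ℝ Ψ x) :
    pd i (fun y => f (Ψ y)) x = d * pd i Ψ x := by
  have h : HasFDerivAt (fun y => f (Ψ y)) (d • fderiv ℝ Ψ x) x :=
    hf.comp_hasFDerivAt x hΨ.hasFDerivAt
  simp [pd, h.fderiv]

lemma pd_mul {a b : (Fin 3 → ℝ) → ℝ} {x : Fin 3 → ℝ} (i : Fin 3)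
    (ha : DifferentiableAt ℝ a x) (hb : DifferentiableAt ℝ b x) :
    pd i (fun y => a y * b y) x = a x * pd i b x + b x * pd i a x := by
  simp [pd, fderiv_fun_mul ha hb]

/-- if `ξ` is harmonic and tangent to the level sets of `Ψ`, and `f` is nowhere
zero, then `w = f(Ψ)ξ` with anisotropy `γ = 1 − 1/f(Ψ)²` is an equilibrium of anisotropic
magnetohydrodynamics with zero reference pressure:
`(1−γ)(∇×w)×w = −(1/2)|w|²∇γ + (w·∇γ)w` and `∇·w = 0`. -/
theorem anisotropic_mhd_equilibrium
    (Ω : Set (Fin 3 → ℝ)) (hΩ : IsOpen Ω)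
    (Ψ : (Fin 3 → ℝ) → ℝ) (hΨ : ContDiffOn ℝ 1 Ψ Ω)
    (ξ : (Fin 3 → ℝ) → (Fin 3 → ℝ)) (hξ : ContDiffOn ℝ 1 ξ Ω)
    (hcurl : ∀ x ∈ Ω, curl ξ x = 0)
    (hdiv : ∀ x ∈ Ω, div3 ξ x = 0)
    (htan : ∀ x ∈ Ω, dot3 (ξ x) (grad Ψ x) = 0)
    (f : ℝ → ℝ) (hf : ContDiff ℝ 1 f) (hfne : ∀ t, f t ≠ 0)
    (w : (Fin 3 → ℝ) → (Fin 3 → ℝ)) (hw : ∀ x, w x = f (Ψ x) • ξ x)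
    (γ : (Fin 3 → ℝ) → ℝ) (hγ : ∀ x, γ x = 1 - 1 / f (Ψ x) ^ 2) :
    (∀ x ∈ Ω, (1 - γ x) • cross3 (curl w x) (w x) =
      (-(1/2) * dot3 (w x) (w x)) • grad γ x + dot3 (w x) (grad γ x) • w x) ∧
    (∀ x ∈ Ω, div3 w x = 0) := by
  obtain rfl : w = fun x => f (Ψ x) • ξ x := funext hw
  obtain rfl : γ = fun x => 1 - 1 / f (Ψ x) ^ 2 := funext hγ
  have hΨd : ∀ x ∈ Ω, DifferentiableAt ℝ Ψ x := fun x hx =>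
    (hΨ.contDiffAt (hΩ.mem_nhds hx)).differentiableAt one_ne_zero
  have hξd : ∀ x ∈ Ω, ∀ j, DifferentiableAt ℝ (fun y => ξ y j) x := fun x hx =>
    differentiableAt_pi.1 ((hξ.contDiffAt (hΩ.mem_nhds hx)).differentiableAt one_ne_zero)
  have hfd : ∀ t, HasDerivAt f (deriv f t) t := fun t =>
    (hf.differentiable one_ne_zero t).hasDerivAt
  have hpw : ∀ x ∈ Ω, ∀ i j, pd i (fun y => f (Ψ y) * ξ y j) x =
      f (Ψ x) * pd i (fun y => ξ y j) x + ξ x j * (deriv f (Ψ x) * pd i Ψ x) := by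
    intro x hx i j
    rw [pd_mul (a := fun y => f (Ψ y)) i ((hfd (Ψ x)).differentiableAt.comp x (hΨd x hx)) (hξd x hx j),
      pd_comp i (hfd (Ψ x)) (hΨd x hx)]
  have hpγ : ∀ x ∈ Ω, ∀ i, pd i (fun y => 1 - 1 / f (Ψ y) ^ 2) x =
      2 * deriv f (Ψ x) / f (Ψ x) ^ 3 * pd i Ψ x := by
    intro x hx i
    have hne := hfne (Ψ x)
    have h : HasDerivAt (fun t => 1 - 1 / f t ^ 2)
        (2 * deriv f (Ψ x) / f (Ψ x) ^ 3) (Ψ x) := by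
      simp only [one_div]
      refine ((((hfd (Ψ x)).fun_pow 2).fun_inv (pow_ne_zero 2 hne)).const_sub 1).congr_deriv ?_
      field_simp
      norm_num
      ring
    exact pd_comp i h (hΨd x hx)
  refine ⟨fun x hx => ?_, fun x hx => ?_⟩
  · have hne := hfne (Ψ x)
    have ht := htan x hx
    have hc := hcurl x hx
    have hc0 := congrFun hc 0
    have hc1 := congrFun hc 1
    have hc2 := congrFun hc 2
    simp only [curl, dot3, grad, Matrix.cons_val, Pi.zero_apply] at ht hc0 hc1 hc2
    have hcw : curl (fun x => f (Ψ x) • ξ x) x =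
        deriv f (Ψ x) • cross3 (grad Ψ x) (ξ x) := by
      ext k
      fin_cases k <;>
        simp only [curl, cross3, grad, Pi.smul_apply, smul_eq_mul, hpw x hx, Fin.zero_eta,
          Fin.mk_one, Fin.reduceFinMk, Matrix.cons_val]
      · linear_combination f (Ψ x) * hc0
      · linear_combination f (Ψ x) * hc1
      · linear_combination f (Ψ x) * hc2
    rw [hcw]
    ext k
    fin_cases k <;>
      simp only [cross3, dot3, grad, Pi.smul_apply, Pi.add_apply, smul_eq_mul, hpγ x hx,
        Fin.zero_eta, Fin.mk_one, Fin.reduceFinMk, Matrix.cons_val] <;>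
      field_simp
    · linear_combination (-(deriv f (Ψ x)) * ξ x 0) * ht
    · linear_combination (-(deriv f (Ψ x)) * ξ x 1) * ht
    · linear_combination (-(deriv f (Ψ x)) * ξ x 2) * ht
  · have hd := hdiv x hx
    have ht := htan x hx
    simp only [div3, dot3, grad, Matrix.cons_val] at hd ht
    simp only [div3, Pi.smul_apply, smul_eq_mul, hpw x hx]
    linear_combination f (Ψ x) * hd + deriv f (Ψ x) * ht
end

section
/- Fix r₀ > 0 and ε > 0. Let P, Q : ℝ² → ℝ be continuously differentiable harmonic conjugates, i.e. ∂P/∂x = ∂Q/∂y and ∂P/∂y = −∂Q/∂x, and let S : ℝ → ℝ be continuously differentiable. On the open set Ω₀ = {(x,y,z) ∈ ℝ³ : r > 0}, define ξ_ε = ∇[φ + ε P(x,y)] = ∇φ + ε∇(P(x,y)) and Ψ_ε = (1/2){[r e^{−εQ(x,y)} − r₀]² + z² e^{−εS(z)}}. Then ∇×ξ_ε = 0 and ξ_ε·∇Ψ_ε = 0 on Ω₀; hence for any continuously differentiable f : ℝ → ℝ, the vector field w = f(Ψ_ε) ξ_ε satisfies [(∇×w)×w]×∇Ψ_ε = 0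 on Ω₀. -/
/-- A real `C¹` function with a harmonic conjugate is the real part of an entire function,
hence `C²`. -/
theorem contDiff_two_of_cauchyRiemann {P Q : ℝ × ℝ → ℝ}
    (hP : Differentiable ℝ P) (hQ : Differentiable ℝ Q)
    (hCR₁ : ∀ q : ℝ × ℝ, fderiv ℝ P q (1, 0) = fderiv ℝ Q q (0, 1))
    (hCR₂ : ∀ q : ℝ × ℝ, fderiv ℝ P q (0, 1) = -fderiv ℝ Q q (1, 0)) :
    ContDiff ℝ 2 P := by
  let e := Complex.equivRealProdCLM
  let F : ℂ → ℂ := fun z => e.symm (P (e z), Q (e z))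
  have hF (z : ℂ) : HasFDerivAt F ((e.symm : ℝ × ℝ →L[ℝ] ℂ).comp
      (((fderiv ℝ P (e z)).comp (e : ℂ →L[ℝ] ℝ × ℝ)).prod
        ((fderiv ℝ Q (e z)).comp (e : ℂ →L[ℝ] ℝ × ℝ)))) z :=
    e.symm.hasFDerivAt.comp z (((hP (e z)).hasFDerivAt.comp z e.hasFDerivAt).prodMk
      ((hQ (e z)).hasFDerivAt.comp z e.hasFDerivAt))
  have hFd : Differentiable ℂ F := fun z => by
    refine differentiableAt_complex_iff_differentiableAt_real.2 ⟨(hF z).differentiableAt, ?_⟩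
    have h1 : e 1 = (1, 0) := by simp [e, Complex.equivRealProdCLM_apply]
    have hI : e Complex.I = (0, 1) := by simp [e, Complex.equivRealProdCLM_apply]
    rw [(hF z).fderiv]
    apply Complex.ext <;>
      simp [h1, hI, e, Complex.equivRealProdCLM_symm_apply, hCR₁, hCR₂]
  have hFc : ContDiff ℝ 2 F := hFd.contDiff.restrict_scalars ℝ
  have hPF : P = fun q => (e (F (e.symm q))).1 := by
    funext q
    simp [F]
  rw [hPF]
  exact contDiff_fst.comp (e.contDiff.comp (hFc.comp e.symm.contDiff))

theorem curl_smul {F : (Fin 3 → ℝ) → ℝ} {v : (Fin 3 → ℝ) → (Fin 3 → ℝ)} {p : Fin 3 → ℝ}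
    (hF : DifferentiableAt ℝ F p) (hv : ∀ i, DifferentiableAt ℝ (fun y => v y i) p) :
    curl (fun y => F y • v y) p = F p • curl v p + cross3 (grad F p) (v p) := by
  have h (i j : Fin 3) : pd j (fun y => F y * v y i) p
      = F p * pd j (fun y => v y i) p + v p i * pd j F p := by
    have := (hF.hasFDerivAt.mul (hv i).hasFDerivAt).fderiv
    simp only [pd]
    erw [this]
    simp
  ext i
  fin_cases i <;> simp [curl, cross3, grad, h] <;> ring

theorem grad_comp {f : ℝ → ℝ} {F : (Fin 3 → ℝ) → ℝ} {p : Fin 3 → ℝ}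
    (hf : DifferentiableAt ℝ f (F p)) (hF : DifferentiableAt ℝ F p) :
    grad (fun y => f (F y)) p = deriv f (F p) • grad F p := by
  have h := (hf.hasDerivAt.comp_hasFDerivAt p hF.hasFDerivAt).fderiv
  have h' (j : Fin 3) : pd j (fun y => f (F y)) p = deriv f (F p) * pd j F p := by
    simp only [pd]
    erw [h]
    simp
  ext i
  fin_cases i <;> simp [grad, h']

/-- The double cross product of `g` with a vector orthogonal to it is parallel to `g`. -/
theorem cross3_cross3_cross3_eq_zero {g v : Fin 3 → ℝ} (a b : ℝ) (h : dot3 v g = 0) :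
    cross3 (cross3 (a • cross3 g v) (b • v)) g = 0 := by
  simp only [dot3] at h
  ext i
  fin_cases i <;> simp [cross3]
  · linear_combination a * b * (v 1 * g 2 - v 2 * g 1) * h
  · linear_combination a * b * (v 2 * g 0 - v 0 * g 2) * h
  · linear_combination a * b * (v 0 * g 1 - v 1 * g 0) * h

theorem sq_add_sq_pos_of_cylR_pos {p : Fin 3 → ℝ} (h : 0 < cylR p) : 0 < p 0 ^ 2 + p 1 ^ 2 :=
  Real.sqrt_pos.1 h

/-- The projection `(x, y, z) ↦ (x, y)`. -/
def projXY : (Fin 3 → ℝ) →L[ℝ] ℝ × ℝ :=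
  (ContinuousLinearMap.proj 0).prod (ContinuousLinearMap.proj 1)

theorem HasFDerivAt.comp_projXY {g : ℝ × ℝ → ℝ} {g' : ℝ × ℝ →L[ℝ] ℝ} {p : Fin 3 → ℝ}
    (hg : HasFDerivAt g g' (p 0, p 1)) :
    HasFDerivAt (fun y : Fin 3 → ℝ => g (y 0, y 1)) (g'.comp projXY) p :=
  HasFDerivAt.comp (f := projXY) p hg projXY.hasFDerivAt

theorem hasFDerivAt_coord (i : Fin 3) (p : Fin 3 → ℝ) :
    HasFDerivAt (fun y : Fin 3 → ℝ => y i) (ContinuousLinearMap.proj (R := ℝ) i) p :=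
  hasFDerivAt_apply i p

theorem hasFDerivAt_sq_add_sq (p : Fin 3 → ℝ) :
    HasFDerivAt (fun y : Fin 3 → ℝ => y 0 ^ 2 + y 1 ^ 2)
      ((2 * p 0) • ContinuousLinearMap.proj (R := ℝ) (φ := fun _ : Fin 3 => ℝ) 0
        + (2 * p 1) • ContinuousLinearMap.proj (R := ℝ) (φ := fun _ : Fin 3 => ℝ) 1) p := by
  refine (((hasFDerivAt_coord 0 p).pow 2).add ((hasFDerivAt_coord 1 p).pow 2)).congr_fderiv ?_
  ext v
  simp

/-- The fields `c / r² + ε g(x,y)`, with `c` linear, which are the components of `ξ_ε`. -/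
theorem hasFDerivAt_div_add {c : (Fin 3 → ℝ) →L[ℝ] ℝ} (ε : ℝ) {g : ℝ × ℝ → ℝ}
    {g' : ℝ × ℝ →L[ℝ] ℝ} {p : Fin 3 → ℝ} (hg : HasFDerivAt g g' (p 0, p 1))
    (hp : 0 < cylR p) :
    ∃ D : (Fin 3 → ℝ) →L[ℝ] ℝ,
      HasFDerivAt (fun y => c y / (y 0 ^ 2 + y 1 ^ 2) + ε * g (y 0, y 1)) D p ∧
      ∀ v, D v = (c v * (p 0 ^ 2 + p 1 ^ 2) - c p * (2 * p 0 * v 0 + 2 * p 1 * v 1))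
        / (p 0 ^ 2 + p 1 ^ 2) ^ 2 + ε * g' (v 0, v 1) := by
  have hr := (sq_add_sq_pos_of_cylR_pos hp).ne'
  have hinv := (hasDerivAt_inv hr).comp_hasFDerivAt p (hasFDerivAt_sq_add_sq p)
  simp only [div_eq_mul_inv _ (_ + _ : ℝ)]
  refine ⟨_, (c.hasFDerivAt.mul hinv).add (hg.comp_projXY.const_mul ε), fun v => ?_⟩
  simp [projXY]
  field_simp
  ring

theorem hasFDerivAt_psi {r₀ ε : ℝ} {Q : ℝ × ℝ → ℝ} (hQ : Differentiable ℝ Q)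
    {S : ℝ → ℝ} (hS : Differentiable ℝ S) {p : Fin 3 → ℝ} (hp : 0 < cylR p) :
    ∃ D : (Fin 3 → ℝ) →L[ℝ] ℝ,
      HasFDerivAt (fun y => (1/2) * ((cylR y * Real.exp (-ε * Q (y 0, y 1)) - r₀) ^ 2 +
        y 2 ^ 2 * Real.exp (-ε * S (y 2)))) D p ∧
      ∀ v, v 2 = 0 → D v = (cylR p * Real.exp (-ε * Q (p 0, p 1)) - r₀) *
        Real.exp (-ε * Q (p 0, p 1)) *
        ((p 0 * v 0 + p 1 * v 1) / cylR p - ε * cylR p * fderiv ℝ Q (p 0, p 1) (v 0, v 1)) := by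
  have hr := (sq_add_sq_pos_of_cylR_pos hp).ne'
  have h1 : HasFDerivAt cylR _ p := (hasFDerivAt_sq_add_sq p).sqrt hr
  have h2 := (((hQ (p 0, p 1)).hasFDerivAt.comp_projXY (p := p)).const_mul (-ε)).exp
  have h3 := (((hS (p 2)).hasDerivAt.comp_hasFDerivAt p (hasFDerivAt_coord 2 p)).const_mul
    (-ε)).exp
  refine ⟨_, ((((h1.mul h2).sub_const r₀).pow 2).add
    (((hasFDerivAt_coord 2 p).pow 2).mul h3)).const_mul (1/2), fun v hv => ?_⟩
  have hc : Real.sqrt (p 0 ^ 2 + p 1 ^ 2) = cylR p := rfl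
  simp [projXY, hv, hc]
  field_simp
  ring

/-- for harmonic conjugates `P, Q` on the plane and any `S`, the field
`ξ_ε = ∇[φ + εP(x,y)]` is curl-free and tangent to the level sets of
`Ψ_ε = (1/2){[r e^{−εQ(x,y)} − r₀]² + z² e^{−εS(z)}}` on `{r > 0}`; hence for any `C¹` function
`f`, the field `w = f(Ψ_ε) ξ_ε` satisfies `[(∇×w)×w]×∇Ψ_ε = 0` on `{r > 0}`. -/
theorem harmonic_conjugate_family
    (r₀ ε : ℝ) (hr₀ : 0 < r₀) (hε : 0 < ε)
    (P Q : ℝ × ℝ → ℝ) (hP : ContDiff ℝ 1 P) (hQ : ContDiff ℝ 1 Q)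
    (hCR₁ : ∀ q : ℝ × ℝ, fderiv ℝ P q (1, 0) = fderiv ℝ Q q (0, 1))
    (hCR₂ : ∀ q : ℝ × ℝ, fderiv ℝ P q (0, 1) = -fderiv ℝ Q q (1, 0))
    (S : ℝ → ℝ) (hS : ContDiff ℝ 1 S)
    (ξ : (Fin 3 → ℝ) → (Fin 3 → ℝ))
    (hξ : ∀ p : Fin 3 → ℝ, ξ p =
      ![-(p 1) / (p 0 ^ 2 + p 1 ^ 2) + ε * fderiv ℝ P (p 0, p 1) (1, 0),
        p 0 / (p 0 ^ 2 + p 1 ^ 2) + ε * fderiv ℝ P (p 0, p 1) (0, 1), 0])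
    (Ψ : (Fin 3 → ℝ) → ℝ)
    (hΨ : ∀ p : Fin 3 → ℝ, Ψ p =
      (1/2) * ((cylR p * Real.exp (-ε * Q (p 0, p 1)) - r₀) ^ 2 +
        p 2 ^ 2 * Real.exp (-ε * S (p 2)))) :
    (∀ p : Fin 3 → ℝ, 0 < cylR p → curl ξ p = 0) ∧
    (∀ p : Fin 3 → ℝ, 0 < cylR p → dot3 (ξ p) (grad Ψ p) = 0) ∧
    (∀ f : ℝ → ℝ, ContDiff ℝ 1 f →
      ∀ w : (Fin 3 → ℝ) → (Fin 3 → ℝ), (∀ p, w p = f (Ψ p) • ξ p) →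
      ∀ p : Fin 3 → ℝ, 0 < cylR p →
        cross3 (cross3 (curl w p) (w p)) (grad Ψ p) = 0) := by
  have hQd : Differentiable ℝ Q := hQ.differentiable one_ne_zero
  have hPc : ContDiff ℝ 2 P :=
    contDiff_two_of_cauchyRiemann (hP.differentiable one_ne_zero) hQd hCR₁ hCR₂
  have hPd (q : ℝ × ℝ) : DifferentiableAt ℝ (fderiv ℝ P) q :=
    (hPc.fderiv_right (m := 1) (by norm_num)).differentiable one_ne_zero q
  have hPv (q v : ℝ × ℝ) : HasFDerivAt (fun q => fderiv ℝ P q v)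
      ((fderiv ℝ (fderiv ℝ P) q).flip v) q := by
    simpa using (hPd q).hasFDerivAt.clm_apply (hasFDerivAt_const v q)
  have hsymm (q : ℝ × ℝ) : IsSymmSndFDerivAt ℝ P q :=
    hPc.contDiffAt.isSymmSndFDerivAt (by simp)
  have hξ0 {p : Fin 3 → ℝ} (hp : 0 < cylR p) := hasFDerivAt_div_add
    (c := -ContinuousLinearMap.proj 1) ε (hPv (p 0, p 1) (1, 0)) hp
  have hξ1 {p : Fin 3 → ℝ} (hp : 0 < cylR p) := hasFDerivAt_div_add
    (c := ContinuousLinearMap.proj 0) ε (hPv (p 0, p 1) (0, 1)) hp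
  have e0 : (fun y => ξ y 0) = fun y => (-ContinuousLinearMap.proj (R := ℝ) 1 :
      (Fin 3 → ℝ) →L[ℝ] ℝ) y / (y 0 ^ 2 + y 1 ^ 2) + ε * fderiv ℝ P (y 0, y 1) (1, 0) := by
    funext y
    simp [hξ]
  have e1 : (fun y => ξ y 1) = fun y => (ContinuousLinearMap.proj (R := ℝ) 0 :
      (Fin 3 → ℝ) →L[ℝ] ℝ) y / (y 0 ^ 2 + y 1 ^ 2) + ε * fderiv ℝ P (y 0, y 1) (0, 1) := by
    funext y
    simp [hξ]
  have e2 : (fun y => ξ y 2) = fun _ => 0 := by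
    funext y
    simp [hξ]
  have hξd {p : Fin 3 → ℝ} (hp : 0 < cylR p) (i : Fin 3) :
      DifferentiableAt ℝ (fun y => ξ y i) p := by
    obtain ⟨_, h0, -⟩ := hξ0 hp
    obtain ⟨_, h1, -⟩ := hξ1 hp
    fin_cases i
    · exact e0 ▸ h0.differentiableAt
    · exact e1 ▸ h1.differentiableAt
    · exact e2 ▸ differentiableAt_const 0
  have hcurl (p : Fin 3 → ℝ) (hp : 0 < cylR p) : curl ξ p = 0 := by
    have hr := (sq_add_sq_pos_of_cylR_pos hp).ne'
    obtain ⟨D0, h0, hD0⟩ := hξ0 hp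
    obtain ⟨D1, h1, hD1⟩ := hξ1 hp
    have hs := hsymm (p 0, p 1) (1, 0) (0, 1)
    rw [← e0] at h0
    rw [← e1] at h1
    ext i
    fin_cases i
    · simp [curl, pd, e2, h1.fderiv, hD1, Prod.mk_zero_zero]
    · simp [curl, pd, e2, h0.fderiv, hD0, Prod.mk_zero_zero]
    · simp [curl, pd, h0.fderiv, h1.fderiv, hD0, hD1, hs]
      field_simp
      ring
  have hΨ' : Ψ = _ := funext hΨ
  have hdot (p : Fin 3 → ℝ) (hp : 0 < cylR p) : dot3 (ξ p) (grad Ψ p) = 0 := by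
    obtain ⟨D, hD, hDv⟩ := hasFDerivAt_psi (r₀ := r₀) (ε := ε) hQd
      (hS.differentiable one_ne_zero) hp
    have hr := (sq_add_sq_pos_of_cylR_pos hp).ne'
    have hsq : cylR p ^ 2 = p 0 ^ 2 + p 1 ^ 2 :=
      Real.sq_sqrt (sq_add_sq_pos_of_cylR_pos hp).le
    have hp' := hp.ne'
    have g0 := hDv (Pi.single 0 1) (by simp)
    have g1 := hDv (Pi.single 1 1) (by simp)
    simp at g0 g1
    simp only [dot3, grad, pd, hΨ', hD.fderiv, hξ, Matrix.cons_val, g0, g1, hCR₁, hCR₂, ← hsq]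
    field_simp
    ring
  refine ⟨hcurl, hdot, fun f hf w hw p hp => ?_⟩
  have hΨd : DifferentiableAt ℝ Ψ p := by
    obtain ⟨_, hD, -⟩ := hasFDerivAt_psi (r₀ := r₀) (ε := ε) hQd
      (hS.differentiable one_ne_zero) hp
    exact hΨ' ▸ hD.differentiableAt
  have hfd : DifferentiableAt ℝ f (Ψ p) := hf.differentiable one_ne_zero _
  have hcw : curl w p = deriv f (Ψ p) • cross3 (grad Ψ p) (ξ p) := by
    rw [funext hw, curl_smul (F := fun y => f (Ψ y)) (hfd.comp p hΨd) (hξd hp), hcurl p hp, grad_comp hfd hΨd]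
    ext i
    fin_cases i <;> simp [cross3] <;> ring
  rw [hcw, hw]
  exact cross3_cross3_cross3_eq_zero _ _ (hdot p hp)
end
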